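/- Let N ≥ 1, m ≥ 1, T > 0, and let α, γ satisfy either γ = α > 1 or γ > α = 1. There exists a constant C = C(N,m,T,α,γ) > 0 such that for every f ∈ C^m(ℝ^N), every x ∈ ℝ^N and every 0 < t < T there exists a polynomial P of degree at most m−1 with ( ⨍_{B(x,t)} | t^{−m}(f(y) − P(y)) |^α dy )^{1/α} ≤ C ( ⨍_{B(x,t)} |D^m f(y)|^γ dy )^{1/γ}, where |D^m f(y)| := Σ_{|β|=m} |∂^β f(y)|. -/

import Mathlib

open MeasureTheory Set Metric Filter
open scoped ENNReal NNReal Topology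

noncomputable section

abbrev RN (N : ℕ) := EuclideanSpace ℝ (Fin N)

variable {N : ℕ}

/-- Partial derivative in the `i`-th coordinate direction. -/
def pd {E : Type*} [NormedAddCommGroup E] [NormedSpace ℝ E] (i : Fin N)
    (f : RN N → E) : RN N → E :=
  fun x => fderiv ℝ f x (EuclideanSpace.single i 1)

/-- Multi-index partial derivative `∂^α`. -/
def md {E : Type*} [NormedAddCommGroup E] [NormedSpace ℝ E] (α : Fin N → ℕ)
    (f : RN N → E) : RN N → E :=
  ((List.ofFn fun i : Fin N => (pd i)^[α i]).foldr (· ∘ ·) id) f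

/-- Order `|α|` of a multi-index. -/
def mOrder (α : Fin N → ℕ) : ℕ := ∑ i, α i

/-- Multi-indices of order at most `k`. -/
def idxLe (N k : ℕ) : Finset (Fin N → ℕ) :=
  (Fintype.piFinset fun _ : Fin N => Finset.range (k + 1)).filter fun α => mOrder α ≤ k

/-- Multi-indices of order exactly `k`. -/
def idxEq (N k : ℕ) : Finset (Fin N → ℕ) :=
  (Fintype.piFinset fun _ : Fin N => Finset.range (k + 1)).filter fun α => mOrder α = k

/-- The dilate `φ_t(z) = t^{-N} φ(z/t)`. -/
def dil (φ : RN N → ℝ) (t : ℝ) (z : RN N) : ℝ := φ (t⁻¹ • z) / t ^ N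

/-- Convolution `(u * φ_t)(x)`. -/
def convAt (φ : RN N → ℝ) (t : ℝ) (u : RN N → ℂ) (x : RN N) : ℂ :=
  ∫ y, dil φ t (x - y) • u y

/-- The small maximal function `sup_{0<t<1} |(u * φ_t)(x)|`. -/
def smallMax (φ : RN N → ℝ) (u : RN N → ℂ) (x : RN N) : ℝ≥0∞ :=
  ⨆ t ∈ Ioo (0 : ℝ) 1, ENNReal.ofReal ‖convAt φ t u x‖

/-- The localizable Hardy space quasi-norm `‖u‖_{h^p}` (for `0 < p < ∞`). -/
def hNorm (φ : RN N → ℝ) (p : ℝ) (u : RN N → ℂ) : ℝ≥0∞ :=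
  (∫⁻ x, smallMax φ u x ^ p) ^ (1 / p)

/-- A fixed radial nonnegative smooth function supported in the unit ball with integral 1. -/
structure GoodPhi (φ : RN N → ℝ) : Prop where
  smooth : ContDiff ℝ (⊤ : ℕ∞) φ
  nonneg : ∀ x, 0 ≤ φ x
  radial : ∀ x y : RN N, ‖x‖ = ‖y‖ → φ x = φ y
  supp : tsupport φ ⊆ closedBall 0 1
  int_one : ∫ x, φ x = 1

/-- The closed axes-parallel cube with center `c` and side length `ℓ`. -/
def cube (c : RN N) (ℓ : ℝ) : Set (RN N) := {y | ∀ i, |y i - c i| ≤ ℓ / 2}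

/-- The open axes-parallel cube with center `c` and side length `ℓ`
(the interior of `cube c ℓ` when `ℓ > 0`). -/
def openCube (c : RN N) (ℓ : ℝ) : Set (RN N) := {y | ∀ i, |y i - c i| < ℓ / 2}

/-- `P` is a (complex) polynomial in `N` variables of degree at most `d`. -/
def IsPolyDegLE (N d : ℕ) (P : RN N → ℂ) : Prop :=
  ∃ c : (Fin N → ℕ) → ℂ, ∀ x : RN N, P x = ∑ α ∈ idxLe N d, c α * ∏ i, ((x i : ℝ) : ℂ) ^ α i

lemma ContDiff.pd {E : Type*} [NormedAddCommGroup E] [NormedSpace ℝ E] {k : ℕ} {f : RN N → E}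
    (hf : ContDiff ℝ (k + 1 : ℕ) f) (i : Fin N) : ContDiff ℝ k (pd i f) := by
  have h : ContDiff ℝ k (fderiv ℝ f) := hf.fderiv_right (by norm_cast)
  exact h.clm_apply contDiff_const

lemma pd_comm {E : Type*} [NormedAddCommGroup E] [NormedSpace ℝ E] {f : RN N → E}
    (hf : ContDiff ℝ 2 f) (i j : Fin N) : pd i (pd j f) = pd j (pd i f) := by
  funext x
  have h : Differentiable ℝ (fderiv ℝ f) :=
    (hf.fderiv_right (m := 1) (by norm_num)).differentiable (by norm_num)
  have key (a b : Fin N) : pd a (pd b f) x =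
      fderiv ℝ (fderiv ℝ f) x (EuclideanSpace.single a 1) (EuclideanSpace.single b 1) := by
    unfold pd
    rw [fderiv_clm_apply h.differentiableAt (differentiableAt_const _)]
    simp
  rw [key, key]
  exact (hf.contDiffAt.isSymmSndFDerivAt (by simp)).eq _ _

/-- Iterated partial derivatives along a word, the head of the word being differentiated first. -/
def iterPd {E : Type*} [NormedAddCommGroup E] [NormedSpace ℝ E] (l : List (Fin N))
    (f : RN N → E) : RN N → E :=
  l.foldl (fun g i => pd i g) f

section Words

variable {E : Type*} [NormedAddCommGroup E] [NormedSpace ℝ E]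

lemma contDiff_iterPd (l : List (Fin N)) {k : ℕ} {f : RN N → E}
    (hf : ContDiff ℝ (k + l.length : ℕ) f) : ContDiff ℝ k (iterPd l f) := by
  induction l generalizing f with
  | nil => exact hf
  | cons i l ih => exact ih (ContDiff.pd (by exact_mod_cast hf) i)

lemma iterPd_perm {l l' : List (Fin N)} (h : l.Perm l') {f : RN N → E}
    (hf : ContDiff ℝ l.length f) : iterPd l f = iterPd l' f := by
  induction h generalizing f with
  | nil => rfl
  | cons i _ ih => exact ih (ContDiff.pd (by exact_mod_cast hf) i)
  | swap i j l =>
    have h2 : ContDiff ℝ 2 f := hf.of_le (by simp; norm_cast; omega)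
    simp only [iterPd, List.foldl_cons, pd_comm h2 i j]
  | trans h₁ _ ih₁ ih₂ => exact (ih₁ hf).trans (ih₂ (h₁.length_eq ▸ hf))

lemma md_eq_iterPd (α : Fin N → ℕ) (f : RN N → E) :
    md α f = iterPd ((List.finRange N).flatMap fun i => List.replicate (α i) i).reverse f := by
  have hrep (i : Fin N) (n : ℕ) (g : RN N → E) : (pd i)^[n] g = (List.replicate n i).foldr pd g := by
    induction n with
    | zero => rfl
    | succ n ih => rw [Function.iterate_succ_apply', ih, List.replicate_succ, List.foldr_cons]
  unfold md iterPd
  rw [List.foldl_reverse, List.ofFn_eq_map]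
  induction List.finRange N with
  | nil => rfl
  | cons i L ih =>
    simp only [List.map_cons, List.foldr_cons, Function.comp_apply, List.flatMap_cons,
      List.foldr_append, ih, hrep]

lemma iterPd_eq_md (l : List (Fin N)) {f : RN N → E} (hf : ContDiff ℝ l.length f) :
    iterPd l f = md (fun i => l.count i) f := by
  rw [md_eq_iterPd]
  refine iterPd_perm ?_ hf
  rw [List.perm_iff_count]
  intro a
  rw [List.count_reverse, List.count_flatMap, ← Fin.sum_univ_def]
  simp [List.count_replicate]

lemma count_mem_idxEq (l : List (Fin N)) : (fun i => l.count i) ∈ idxEq N l.length := by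
  refine Finset.mem_filter.mpr ⟨Fintype.mem_piFinset.mpr fun i =>
    Finset.mem_range.mpr (Nat.lt_succ_of_le List.count_le_length), ?_⟩
  unfold mOrder
  induction l with
  | nil => simp
  | cons i l ih => simp [List.count_cons, Finset.sum_add_distrib, ih]

lemma contDiff_md {α : Fin N → ℕ} {k : ℕ} {f : RN N → E}
    (hf : ContDiff ℝ (k + mOrder α : ℕ) f) : ContDiff ℝ k (md α f) := by
  rw [md_eq_iterPd]
  apply contDiff_iterPd
  rwa [List.length_reverse, List.length_flatMap, ← Fin.sum_univ_def, Finset.sum_congr rfl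
    fun i _ => List.length_replicate]

/-- The `k`-th directional derivative of `f` at `p` in direction `v`, expanded in coordinates. -/
def dirDeriv : ℕ → (RN N → E) → RN N → RN N → E
  | 0, f, p, _ => f p
  | k + 1, f, p, v => ∑ i, v i • dirDeriv k (pd i f) p v

lemma iteratedDeriv_comp_line {k : ℕ} {f : RN N → E} (hf : ContDiff ℝ k f) (p v : RN N) (s : ℝ) :
    iteratedDeriv k (fun s : ℝ => f (p + s • v)) s = dirDeriv k f (p + s • v) v := by
  induction k generalizing f with
  | zero => simp [dirDeriv]
  | succ k ih =>
    have hderiv : deriv (fun s : ℝ => f (p + s • v)) =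
        fun s => ∑ i, v i • pd i f (p + s • v) := by
      funext s
      have hline : HasDerivAt (fun s : ℝ => p + s • v) v s := by
        simpa using ((hasDerivAt_id s).smul_const v).const_add p
      have hfd : HasFDerivAt f (fderiv ℝ f (p + s • v)) (p + s • v) :=
        (hf.differentiable (by simp)).differentiableAt.hasFDerivAt
      refine (hfd.comp_hasDerivAt s hline).deriv.trans ?_
      conv_lhs => enter [2]; rw [← (EuclideanSpace.basisFun (Fin N) ℝ).sum_repr v]
      simp [pd]
    have hcd (i : Fin N) : ContDiff ℝ k fun s : ℝ => pd i f (p + s • v) :=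
      (hf.pd i).comp (by fun_prop)
    rw [iteratedDeriv_succ', hderiv,
      iteratedDeriv_fun_sum fun i _ => ((hcd i).const_smul (v i)).contDiffAt]
    refine Finset.sum_congr rfl fun i _ => ?_
    rw [iteratedDeriv_fun_const_smul_field, ih (hf.pd i)]

lemma norm_dirDeriv_le {k : ℕ} {f : RN N → E} {p v : RN N} {M : ℝ}
    (hM : ∀ l : List (Fin N), l.length = k → ‖iterPd l f p‖ ≤ M) :
    ‖dirDeriv k f p v‖ ≤ (N * ‖v‖) ^ k * M := by
  induction k generalizing f with
  | zero => simpa [dirDeriv, iterPd] using hM [] rfl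
  | succ k ih =>
    have h (i : Fin N) : ‖v i • dirDeriv k (pd i f) p v‖ ≤ ‖v‖ * ((N * ‖v‖) ^ k * M) := by
      rw [norm_smul]
      have := ih (f := pd i f) fun l hl => hM (i :: l) (by simp [hl])
      gcongr
      exact PiLp.norm_apply_le v i
    calc _ ≤ ∑ i : Fin N, ‖v‖ * ((N * ‖v‖) ^ k * M) := norm_sum_le_of_le _ fun i _ => h i
      _ = _ := by simp; ring

lemma norm_dirDeriv_le_sum_md {k : ℕ} {f : RN N → E} (hf : ContDiff ℝ k f) (p v : RN N) :
    ‖dirDeriv k f p v‖ ≤ (N * ‖v‖) ^ k * ∑ β ∈ idxEq N k, ‖md β f p‖ := by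
  refine norm_dirDeriv_le fun l hl => ?_
  subst hl
  rw [iterPd_eq_md l hf]
  exact Finset.single_le_sum (f := fun β => ‖md β f p‖) (fun _ _ => norm_nonneg _)
    (count_mem_idxEq l)

lemma continuous_sum_norm_md {k : ℕ} {f : RN N → E} (hf : ContDiff ℝ k f) :
    Continuous fun p => ∑ β ∈ idxEq N k, ‖md β f p‖ := by
  refine continuous_finsetSum _ fun β hβ => Continuous.norm ?_
  have hβ' : mOrder β = k := (Finset.mem_filter.mp hβ).2
  exact (contDiff_md (k := 0) (by simpa [hβ'] using hf)).continuous

/-- Taylor polynomial of degree `k` of `f` at `z`, as a function of `y`. -/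
def taylorPoly (k : ℕ) (f : RN N → E) (z y : RN N) : E :=
  ∑ j ∈ Finset.range (k + 1), (j.factorial : ℝ)⁻¹ • dirDeriv j f z (y - z)

lemma norm_sub_taylorPoly_le [CompleteSpace E] {k : ℕ} {f : RN N → E}
    (hf : ContDiff ℝ (k + 1 : ℕ) f) (z y : RN N) :
    ‖f y - taylorPoly k f z y‖ ≤ (N * ‖y - z‖) ^ (k + 1) *
      ∫ s in (0 : ℝ)..1, ∑ β ∈ idxEq N (k + 1), ‖md β f (z + s • (y - z))‖ := by
  set h : ℝ → E := fun s => f (z + s • (y - z))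
  have hh : ContDiff ℝ (k + 1 : ℕ) h := hf.comp (by fun_prop)
  have hder {j : ℕ} (hj : j ≤ k + 1) {s : ℝ} (hs : s ∈ uIcc (0 : ℝ) 1) :
      iteratedDerivWithin j h (uIcc 0 1) s = dirDeriv j f (z + s • (y - z)) (y - z) := by
    have hj' : ((j : ℕ) : WithTop ℕ∞) ≤ (k + 1 : ℕ) := by exact_mod_cast hj
    rw [iteratedDerivWithin_eq_iteratedDeriv (uniqueDiffOn_uIcc zero_ne_one)
      (hh.of_le hj').contDiffAt hs, iteratedDeriv_comp_line (hf.of_le hj')]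
  have ht := taylor_integral_remainder (f := h) (x₀ := 0) (x := 1) (n := k) hh.contDiffOn
  have hP : taylorWithinEval h k (uIcc 0 1) 0 1 = taylorPoly k f z y := by
    rw [taylor_within_apply, taylorPoly]
    refine Finset.sum_congr rfl fun j hj => ?_
    rw [hder (by have := Finset.mem_range.mp hj; omega) left_mem_uIcc]
    simp
  rw [hP] at ht
  have h1 : h 1 = f y := by simp [h]
  rw [← h1, ht, ← intervalIntegral.integral_const_mul]
  refine intervalIntegral.norm_integral_le_of_norm_le zero_le_one ?_ ?_
  · refine ae_of_all _ fun s hs => ?_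
    have hs' : s ∈ uIcc (0 : ℝ) 1 := by
      rw [uIcc_of_le zero_le_one]; exact ⟨hs.1.le, hs.2⟩
    rw [hder le_rfl hs', norm_smul]
    refine (mul_le_of_le_one_left (norm_nonneg _) ?_).trans (norm_dirDeriv_le_sum_md hf _ _)
    have h0 : 0 ≤ 1 - s := by linarith [hs.2]
    rw [Real.norm_of_nonneg (by positivity)]
    refine div_le_one_of_le₀ ?_ (by positivity)
    exact (pow_le_one₀ h0 (by linarith [hs.1])).trans (by exact_mod_cast Nat.factorial_pos k)
  · refine Continuous.intervalIntegrable (continuous_const.mul ?_) _ _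
    exact (continuous_sum_norm_md hf).comp (by fun_prop)

end Words

lemma isPolyDegLE_eval {d : ℕ} {p : MvPolynomial (Fin N) ℂ} (hp : p.totalDegree ≤ d) :
    IsPolyDegLE N d fun x => MvPolynomial.eval (fun i => ((x i : ℝ) : ℂ)) p := by
  refine ⟨fun β => p.coeff (Finsupp.equivFunOnFinite.symm β), fun x => ?_⟩
  refine (MvPolynomial.eval_eq' _ _).trans ?_
  have hsub : p.support.map Finsupp.equivFunOnFinite.toEmbedding ⊆ idxLe N d := by
    intro β hβ
    obtain ⟨b, hb, rfl⟩ := Finset.mem_map.mp hβ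
    have hle : ∑ i, b i ≤ d := by
      rw [← Finsupp.sum_fintype b (fun _ e => e) fun _ => rfl]
      exact (MvPolynomial.le_totalDegree hb).trans hp
    exact Finset.mem_filter.mpr ⟨Fintype.mem_piFinset.mpr fun i =>
      Finset.mem_range.mpr (Nat.lt_succ_of_le
        ((Finset.single_le_sum (f := fun i => b i) (by simp) (Finset.mem_univ i)).trans hle)), hle⟩
  rw [← Finset.sum_subset hsub, Finset.sum_map]
  · simp
  · intro β _ hβ
    have : p.coeff (Finsupp.equivFunOnFinite.symm β) = 0 := by
      by_contra h
      exact hβ (Finset.mem_map.mpr ⟨_, MvPolynomial.mem_support_iff.mpr h, by simp⟩)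
    exact mul_eq_zero_of_left this _

lemma exists_mvPolynomial_dirDeriv (k : ℕ) (f : RN N → ℂ) (z : RN N) :
    ∃ p : MvPolynomial (Fin N) ℂ, p.totalDegree ≤ k ∧
      ∀ y, MvPolynomial.eval (fun i => ((y i : ℝ) : ℂ)) p = dirDeriv k f z (y - z) := by
  induction k generalizing f with
  | zero => exact ⟨MvPolynomial.C (f z), by simp, fun y => by simp [dirDeriv]⟩
  | succ k ih =>
    choose q hq hqe using fun i => ih (pd i f)
    refine ⟨∑ i, (MvPolynomial.X i - MvPolynomial.C ((z i : ℝ) : ℂ)) * q i, ?_, fun y => ?_⟩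
    · refine (MvPolynomial.totalDegree_finsetSum _ _).trans (Finset.sup_le fun i _ => ?_)
      refine (MvPolynomial.totalDegree_mul _ _).trans ?_
      have := MvPolynomial.totalDegree_sub_C_le (MvPolynomial.X i) ((z i : ℝ) : ℂ)
      rw [MvPolynomial.totalDegree_X] at this
      have := hq i
      omega
    · simp [dirDeriv, hqe, Complex.real_smul]

lemma isPolyDegLE_taylorPoly (k : ℕ) (f : RN N → ℂ) (z : RN N) :
    IsPolyDegLE N k (taylorPoly k f z) := by
  choose p hp hpe using fun j => exists_mvPolynomial_dirDeriv j f z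
  have h : taylorPoly k f z = fun y => MvPolynomial.eval (fun i => ((y i : ℝ) : ℂ))
      (∑ j ∈ Finset.range (k + 1), MvPolynomial.C ((j.factorial : ℂ)⁻¹) * p j) := by
    funext y
    simp [taylorPoly, hpe, Complex.real_smul]
  rw [h]
  refine isPolyDegLE_eval ((MvPolynomial.totalDegree_finsetSum _ _).trans
    (Finset.sup_le fun j hj => (MvPolynomial.totalDegree_mul _ _).trans ?_))
  rw [MvPolynomial.totalDegree_C, zero_add]
  exact (hp j).trans (Nat.lt_succ_iff.mp (Finset.mem_range.mp hj))

lemma IsPolyDegLE.continuous {d : ℕ} {P : RN N → ℂ} (hP : IsPolyDegLE N d P) : Continuous P := by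
  obtain ⟨c, hc⟩ := hP
  rw [funext hc]
  fun_prop

lemma setLIntegral_ball_comp_contraction_le {φ : RN N → ℝ≥0∞} (hφ : Measurable φ) {x z : RN N}
    {t : ℝ} (hz : z ∈ ball x t) {s : ℝ} (hs : s ∈ Icc (1 / 2 : ℝ) 1) :
    ∫⁻ y in ball x t, φ (z + s • (y - z)) ≤ 2 ^ N * ∫⁻ y in ball x t, φ y := by
  have hs0 : 0 < s := by linarith [hs.1]
  set ψ : RN N → ℝ≥0∞ := (ball x t).indicator φ
  have hψ : Measurable ψ := hφ.indicator measurableSet_ball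
  have hmem {y : RN N} (hy : y ∈ ball x t) : z + s • (y - z) ∈ ball x t :=
    (convex_ball x t).add_smul_sub_mem hz hy ⟨hs0.le, hs.2⟩
  calc ∫⁻ y in ball x t, φ (z + s • (y - z))
      = ∫⁻ y in ball x t, ψ (z + s • (y - z)) :=
        setLIntegral_congr_fun measurableSet_ball fun y hy => (indicator_of_mem (hmem hy) φ).symm
    _ ≤ ∫⁻ y, ψ (z + s • (y - z)) := setLIntegral_le_lintegral _ _
    _ = ∫⁻ y, ψ ((z - s • z) + s • y) := by
        refine lintegral_congr fun y => ?_
        congr 1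
        rw [smul_sub]; abel
    _ = ∫⁻ w, ψ ((z - s • z) + w) ∂(Measure.map (s • ·) volume) :=
        (lintegral_map (hψ.comp (measurable_const_add _)) (measurable_const_smul s)).symm
    _ = ENNReal.ofReal |(s ^ N)⁻¹| * ∫⁻ w, ψ w := by
        rw [Measure.map_addHaar_smul _ hs0.ne', lintegral_smul_measure,
          lintegral_add_left_eq_self, finrank_euclideanSpace_fin, smul_eq_mul]
    _ ≤ 2 ^ N * ∫⁻ y in ball x t, φ y := by
        rw [lintegral_indicator measurableSet_ball]
        gcongr
        rw [abs_of_pos (by positivity), ← inv_pow, ENNReal.ofReal_pow (by positivity)]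
        gcongr
        refine ENNReal.ofReal_le_of_le_toReal ?_
        rw [ENNReal.toReal_ofNat]
        exact inv_le_of_inv_le₀ (by norm_num) (by linarith [hs.1])

lemma setLIntegral_setLIntegral_ball_segment_le {φ : RN N → ℝ≥0∞} (hφ : Measurable φ) (x : RN N)
    (t : ℝ) {s : ℝ} (hs : s ∈ Icc (0 : ℝ) 1) :
    ∫⁻ z in ball x t, ∫⁻ y in ball x t, φ (z + s • (y - z)) ≤
      2 ^ N * (∫⁻ y in ball x t, φ y) * volume (ball x t) := by
  rcases le_total (1 / 2) s with h | h
  · exact (setLIntegral_mono measurable_const fun z hz =>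
      setLIntegral_ball_comp_contraction_le hφ hz ⟨h, hs.2⟩).trans_eq (setLIntegral_const _ _)
  · rw [lintegral_lintegral_swap (by fun_prop)]
    refine (setLIntegral_mono measurable_const fun y hy => ?_).trans_eq (setLIntegral_const _ _)
    have hswap (z : RN N) : z + s • (y - z) = y + (1 - s) • (z - y) := by module
    simp_rw [hswap]
    exact setLIntegral_ball_comp_contraction_le hφ hy ⟨by linarith, by linarith [hs.1]⟩

lemma exists_center_setLIntegral_segment_le {φ : RN N → ℝ≥0∞} (hφ : Measurable φ) (x : RN N)
    {t : ℝ} (ht : 0 < t) :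
    ∃ z ∈ ball x t, ∫⁻ y in ball x t, ∫⁻ s in Ioc (0 : ℝ) 1, φ (z + s • (y - z)) ≤
      2 ^ N * ∫⁻ y in ball x t, φ y := by
  have h0 : volume (ball x t) ≠ 0 := (measure_ball_pos volume x ht).ne'
  have htop : volume (ball x t) ≠ ∞ := measure_ball_lt_top.ne
  have hmeas : Measurable fun q : (RN N × RN N) × ℝ => φ (q.1.1 + q.2 • (q.1.2 - q.1.1)) := by
    fun_prop
  have hmeas' : Measurable fun q : RN N × RN N =>
      ∫⁻ s in Ioc (0 : ℝ) 1, φ (q.1 + s • (q.2 - q.1)) := hmeas.lintegral_prod_right'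
  obtain ⟨z, hz, hle⟩ := exists_le_setLAverage h0 htop
    (f := fun z => ∫⁻ y in ball x t, ∫⁻ s in Ioc (0 : ℝ) 1, φ (z + s • (y - z)))
    hmeas'.lintegral_prod_right'.aemeasurable
  refine ⟨z, hz, hle.trans ?_⟩
  rw [setLAverage_eq]
  refine ENNReal.div_le_of_le_mul ?_
  have hinner : ∀ z, ∫⁻ y in ball x t, ∫⁻ s in Ioc (0 : ℝ) 1, φ (z + s • (y - z)) =
      ∫⁻ s in Ioc (0 : ℝ) 1, ∫⁻ y in ball x t, φ (z + s • (y - z)) := fun z =>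
    lintegral_lintegral_swap (by fun_prop)
  have hmeas'' : Measurable fun q : RN N × ℝ =>
      ∫⁻ y in ball x t, φ (q.1 + q.2 • (y - q.1)) := by
    refine Measurable.lintegral_prod_right'
      (f := fun q : (RN N × ℝ) × RN N => φ (q.1.1 + q.1.2 • (q.2 - q.1.1))) ?_
    fun_prop
  simp_rw [hinner]
  rw [lintegral_lintegral_swap hmeas''.aemeasurable]
  refine (setLIntegral_mono measurable_const fun s hs =>
    setLIntegral_setLIntegral_ball_segment_le hφ x t ⟨hs.1.le, hs.2⟩).trans_eq ?_
  simp

lemma rpow_intervalIntegral_le {h : ℝ → ℝ} (hh : Continuous h) (h0 : ∀ s, 0 ≤ h s) {α : ℝ}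
    (hα : 1 ≤ α) : (∫ s in (0 : ℝ)..1, h s) ^ α ≤ ∫ s in (0 : ℝ)..1, h s ^ α := by
  have hα0 : 0 ≤ α := zero_le_one.trans hα
  have : IsProbabilityMeasure (volume.restrict (Ioc (0 : ℝ) 1)) := ⟨by simp⟩
  rw [intervalIntegral.integral_of_le zero_le_one, intervalIntegral.integral_of_le zero_le_one]
  refine (convexOn_rpow hα).map_integral_le (Real.continuous_rpow_const hα0).continuousOn
    isClosed_Ici (ae_of_all _ h0) ?_ ?_
  · exact (hh.integrableOn_Icc (μ := volume)).mono_set Ioc_subset_Icc_self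
  · exact ((hh.rpow_const fun _ => Or.inr hα0).integrableOn_Icc (μ := volume)).mono_set
      Ioc_subset_Icc_self

lemma Continuous.integrableOn_ball {F : Type*} [NormedAddCommGroup F] {h : RN N → F}
    (hh : Continuous h) (x : RN N) (t : ℝ) : IntegrableOn h (ball x t) :=
  (hh.continuousOn.integrableOn_compact (isCompact_closedBall x t)).mono_set
    ball_subset_closedBall

lemma setAverage_rpow_rpow_inv_le {g : RN N → ℝ} (hg : Continuous g) (g0 : ∀ y, 0 ≤ g y)
    {α γ : ℝ} (hα : 0 < α) (hαγ : α ≤ γ) (x : RN N) {t : ℝ} (ht : 0 < t) :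
    (⨍ y in ball x t, g y ^ α) ^ (1 / α) ≤ (⨍ y in ball x t, g y ^ γ) ^ (1 / γ) := by
  have hγ : 0 < γ := hα.trans_le hαγ
  have hone : 1 ≤ γ / α := (one_le_div hα).mpr hαγ
  have hgα : Continuous fun y => g y ^ α := hg.rpow_const fun _ => Or.inr hα.le
  have hcomp : (fun r : ℝ => r ^ (γ / α)) ∘ (fun y => g y ^ α) = fun y => g y ^ γ := by
    funext y
    rw [Function.comp_apply, ← Real.rpow_mul (g0 y), mul_div_cancel₀ _ hα.ne']
  have hA : 0 ≤ ⨍ y in ball x t, g y ^ α := integral_nonneg fun y => Real.rpow_nonneg (g0 y) _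
  have hJ := (convexOn_rpow hone).map_set_average_le (t := ball x t) (μ := volume)
    (f := fun y => g y ^ α) (Real.continuous_rpow_const (by positivity)).continuousOn isClosed_Ici
    (measure_ball_pos volume x ht).ne' measure_ball_lt_top.ne
    (ae_of_all _ fun y => Real.rpow_nonneg (g0 y) _) (hgα.integrableOn_ball x t)
    (by rw [hcomp]; exact (hg.rpow_const fun _ => Or.inr hγ.le).integrableOn_ball x t)
  have hpt (y : RN N) : (g y ^ α) ^ (γ / α) = g y ^ γ := congrFun hcomp y
  simp_rw [hpt] at hJ
  calc (⨍ y in ball x t, g y ^ α) ^ (1 / α)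
      = ((⨍ y in ball x t, g y ^ α) ^ (γ / α)) ^ (1 / γ) := by
        rw [← Real.rpow_mul hA]; congr 1; field_simp
    _ ≤ _ := by gcongr

lemma rpow_inv_pow_mul_norm_sub_taylorPoly_le {E : Type*} [NormedAddCommGroup E]
    [NormedSpace ℝ E] [CompleteSpace E] {k : ℕ} {f : RN N → E} (hf : ContDiff ℝ (k + 1 : ℕ) f)
    {α : ℝ} (hα : 1 ≤ α) {x y z : RN N} {t : ℝ} (hz : z ∈ ball x t) (hy : y ∈ ball x t) :
    ((t ^ (k + 1))⁻¹ * ‖f y - taylorPoly k f z y‖) ^ α ≤ ((2 * N : ℝ) ^ (k + 1)) ^ α *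
      ∫ s in (0 : ℝ)..1, (∑ β ∈ idxEq N (k + 1), ‖md β f (z + s • (y - z))‖) ^ α := by
  have ht : 0 < t := dist_nonneg.trans_lt hz
  have hα0 : 0 ≤ α := zero_le_one.trans hα
  have hyz : ‖y - z‖ ≤ 2 * t := by
    rw [← dist_eq_norm]
    linarith [dist_triangle_right y z x, mem_ball.mp hz, mem_ball.mp hy]
  set I := ∫ s in (0 : ℝ)..1, ∑ β ∈ idxEq N (k + 1), ‖md β f (z + s • (y - z))‖ with hI
  have hI0 : 0 ≤ I := intervalIntegral.integral_nonneg zero_le_one fun s _ => by positivity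
  have hle : (t ^ (k + 1))⁻¹ * ‖f y - taylorPoly k f z y‖ ≤ (2 * N : ℝ) ^ (k + 1) * I := by
    rw [inv_mul_le_iff₀ (by positivity)]
    calc ‖f y - taylorPoly k f z y‖ ≤ (N * ‖y - z‖) ^ (k + 1) * I := norm_sub_taylorPoly_le hf z y
      _ ≤ (N * (2 * t)) ^ (k + 1) * I := by gcongr
      _ = t ^ (k + 1) * ((2 * N : ℝ) ^ (k + 1) * I) := by ring
  calc _ ≤ ((2 * N : ℝ) ^ (k + 1) * I) ^ α := by gcongr
    _ = ((2 * N : ℝ) ^ (k + 1)) ^ α * I ^ α := Real.mul_rpow (by positivity) hI0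
    _ ≤ _ := by
      gcongr
      exact rpow_intervalIntegral_le ((continuous_sum_norm_md hf).comp (by fun_prop))
        (fun s => Finset.sum_nonneg fun _ _ => norm_nonneg _) hα

/-- Poincaré inequality on balls with equal exponents, the polynomial being a Taylor polynomial
centred at a suitable point of the ball. -/
lemma exists_setAverage_rpow_sub_taylorPoly_le {k : ℕ} {f : RN N → ℂ}
    (hf : ContDiff ℝ (k + 1 : ℕ) f) {α : ℝ} (hα : 1 ≤ α) (x : RN N) {t : ℝ} (ht : 0 < t) :
    ∃ z ∈ ball x t,
      ⨍ y in ball x t, ((t ^ (k + 1))⁻¹ * ‖f y - taylorPoly k f z y‖) ^ α ≤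
        ((2 * N : ℝ) ^ (k + 1)) ^ α * 2 ^ N *
          ⨍ y in ball x t, (∑ β ∈ idxEq N (k + 1), ‖md β f y‖) ^ α := by
  have hα0 : 0 ≤ α := zero_le_one.trans hα
  set g : RN N → ℝ := fun y => (∑ β ∈ idxEq N (k + 1), ‖md β f y‖) ^ α
  have hg : Continuous g := (continuous_sum_norm_md hf).rpow_const fun _ => Or.inr hα0
  have g0 (y : RN N) : 0 ≤ g y :=
    Real.rpow_nonneg (Finset.sum_nonneg fun _ _ => norm_nonneg _) _
  obtain ⟨z, hz, hle⟩ := exists_center_setLIntegral_segment_le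
    (φ := fun y => ENNReal.ofReal (g y)) hg.measurable.ennreal_ofReal x ht
  refine ⟨z, hz, ?_⟩
  set K : ℝ := ((2 * N : ℝ) ^ (k + 1)) ^ α
  have hK : 0 ≤ K := by positivity
  set F : RN N → ℝ := fun y => ((t ^ (k + 1))⁻¹ * ‖f y - taylorPoly k f z y‖) ^ α
  have hF : Continuous F := (continuous_const.mul (hf.continuous.sub
    (isPolyDegLE_taylorPoly k f z).continuous).norm).rpow_const fun _ => Or.inr hα0
  have F0 (y : RN N) : 0 ≤ F y := Real.rpow_nonneg (by positivity) _
  have hpt {y : RN N} (hy : y ∈ ball x t) : ENNReal.ofReal (F y) ≤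
      ENNReal.ofReal K * ∫⁻ s in Ioc (0 : ℝ) 1, ENNReal.ofReal (g (z + s • (y - z))) := by
    have hseg : Continuous fun s : ℝ => g (z + s • (y - z)) := hg.comp (by fun_prop)
    rw [← ofReal_integral_eq_lintegral_ofReal
      ((hseg.integrableOn_Icc (μ := volume)).mono_set Ioc_subset_Icc_self)
      (ae_of_all _ fun s => g0 _), ← ENNReal.ofReal_mul hK,
      ← intervalIntegral.integral_of_le zero_le_one]
    exact ENNReal.ofReal_le_ofReal (rpow_inv_pow_mul_norm_sub_taylorPoly_le hf hα hz hy)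
  have h_integral_le : ∫ y in ball x t, F y ≤ K * 2 ^ N * ∫ y in ball x t, g y := by
    have hg_int : 0 ≤ ∫ y in ball x t, g y := integral_nonneg g0
    rw [← ENNReal.ofReal_le_ofReal_iff (by positivity), ENNReal.ofReal_mul (by positivity),
      ENNReal.ofReal_mul hK, ofReal_integral_eq_lintegral_ofReal (hF.integrableOn_ball x t)
      (ae_of_all _ F0), ofReal_integral_eq_lintegral_ofReal (hg.integrableOn_ball x t)
      (ae_of_all _ g0), ENNReal.ofReal_pow zero_le_two, ENNReal.ofReal_ofNat, mul_assoc]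
    calc ∫⁻ y in ball x t, ENNReal.ofReal (F y)
        ≤ ∫⁻ y in ball x t, ENNReal.ofReal K *
            ∫⁻ s in Ioc (0 : ℝ) 1, ENNReal.ofReal (g (z + s • (y - z))) :=
          setLIntegral_mono' measurableSet_ball fun y hy => hpt hy
      _ = _ := lintegral_const_mul' _ _ ENNReal.ofReal_ne_top
      _ ≤ _ := by gcongr
  rw [setAverage_eq, setAverage_eq, smul_eq_mul, smul_eq_mul, mul_left_comm]
  gcongr

/-- Generalized Poincaré inequality on balls. -/
theorem statement4 (N m : ℕ) (hN : 1 ≤ N) (hm : 1 ≤ m) (T : ℝ) (hT : 0 < T)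
    (α γ : ℝ) (hαγ : (γ = α ∧ 1 < α) ∨ (α = 1 ∧ 1 < γ)) :
    ∃ C : ℝ, 0 < C ∧
      ∀ f : RN N → ℂ, ContDiff ℝ (m : ℕ∞) f →
      ∀ (x : RN N) (t : ℝ), 0 < t → t < T →
        ∃ P : RN N → ℂ, IsPolyDegLE N (m - 1) P ∧
          (⨍ y in ball x t, ((t ^ m)⁻¹ * ‖f y - P y‖) ^ α) ^ (1 / α) ≤
            C * (⨍ y in ball x t, (∑ β ∈ idxEq N m, ‖md β f y‖) ^ γ) ^ (1 / γ) := by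

  have hα : 1 ≤ α := by rcases hαγ with ⟨_, h⟩ | ⟨h, _⟩ <;> linarith
  have hle : α ≤ γ := by rcases hαγ with ⟨h, _⟩ | ⟨h, h'⟩ <;> linarith
  obtain ⟨k, rfl⟩ : ∃ k, m = k + 1 := ⟨m - 1, by omega⟩
  have hN0 : (0 : ℝ) < N := by exact_mod_cast hN
  refine ⟨(((2 * N : ℝ) ^ (k + 1)) ^ α * 2 ^ N) ^ (1 / α), by positivity,
    fun f hf x t ht _ => ?_⟩
  have hf' : ContDiff ℝ (k + 1 : ℕ) f := hf
  obtain ⟨z, -, hz⟩ := exists_setAverage_rpow_sub_taylorPoly_le hf' hα x ht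
  refine ⟨taylorPoly k f z, isPolyDegLE_taylorPoly k f z, ?_⟩
  refine (Real.rpow_le_rpow (integral_nonneg fun y => by positivity) hz (by positivity)).trans ?_
  have hA : 0 ≤ ⨍ y in ball x t, (∑ β ∈ idxEq N (k + 1), ‖md β f y‖) ^ α :=
    integral_nonneg fun y => by positivity
  rw [Real.mul_rpow (by positivity) hA]
  gcongr
  exact setAverage_rpow_rpow_inv_le (continuous_sum_norm_md hf') (fun y => by positivity)
    (zero_lt_one.trans_le hα) hle x ht
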